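/- (Birkhoff) Let d ≥ 2 and let A be a d×d real matrix with all entries positive. Then for every x ∈ ℝ^d with all coordinates positive, Ax has all coordinates positive, and the supremum of d_H(Ax, Ay)/d_H(x, y) over all pairs x, y of vectors in ℝ^d with all coordinates positive such that y is not a positive scalar multiple of x equals L(A) = (1 − √ψ(A))/(1 + √ψ(A)), where ψ(A) = min_{i,j,k,ℓ} (a_{ik} a_{jℓ})/(a_{iℓ} a_{jk}). Moreover 0 ≤ L(A) < 1, so A is a strict contraction for the Hilbert pseudo-metric. -/

import Mathlib

/-- Hilbert's pseudo-metric on the positive orthant of `ℝ^d`: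
`d_H(x, y) = log( max_i (x_i / y_i) / min_i (x_i / y_i) )`. -/
noncomputable def hilbertDist {d : ℕ} (x y : Fin d → ℝ) : ℝ :=
  Real.log ((⨆ i, x i / y i) / (⨅ i, x i / y i))

/-- `ψ(A) = min_{i,j,k,ℓ} (a_{ik} a_{jℓ}) / (a_{iℓ} a_{jk})`. -/
noncomputable def psi {d : ℕ} (A : Matrix (Fin d) (Fin d) ℝ) : ℝ :=
  ⨅ i, ⨅ j, ⨅ k, ⨅ l, (A i k * A j l) / (A i l * A j k)

/-- Birkhoff's contraction coefficient `L(A) = (1 − √ψ(A)) / (1 + √ψ(A))`. -/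
noncomputable def birkhoffL {d : ℕ} (A : Matrix (Fin d) (Fin d) ℝ) : ℝ :=
  (1 - Real.sqrt (psi A)) / (1 + Real.sqrt (psi A))

open Finset Filter Topology

/-- The logarithmic ratios `log (x i / y i)` oscillate by at most `hilbertDist x y`. -/
theorem log_sub_log_le_hilbertDist {d : ℕ} {x y : Fin d → ℝ} (hx : ∀ i, 0 < x i)
    (hy : ∀ i, 0 < y i) (i j : Fin d) :
    Real.log (x i / y i) - Real.log (x j / y j) ≤ hilbertDist x y := by
  have : Nonempty (Fin d) := ⟨i⟩
  have hpos : ∀ k, 0 < x k / y k := fun k => div_pos (hx k) (hy k)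
  obtain ⟨m, hm⟩ := exists_eq_ciInf_of_finite (f := fun k => x k / y k)
  have hinf : 0 < ⨅ k, x k / y k := hm ▸ hpos m
  have hsup : x i / y i ≤ ⨆ k, x k / y k :=
    le_ciSup (f := fun k => x k / y k) (Set.finite_range _).bddAbove i
  have hinf_le : ⨅ k, x k / y k ≤ x j / y j :=
    ciInf_le (f := fun k => x k / y k) (Set.finite_range _).bddBelow j
  rw [hilbertDist, Real.log_div ((hpos i).trans_le hsup).ne' hinf.ne']
  exact sub_le_sub (Real.log_le_log (hpos i) hsup) (Real.log_le_log hinf hinf_le)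

/-- `hilbertDist x y` is attained as a difference of logarithmic ratios. -/
theorem exists_hilbertDist_eq {d : ℕ} [Nonempty (Fin d)] {x y : Fin d → ℝ}
    (hx : ∀ i, 0 < x i) (hy : ∀ i, 0 < y i) :
    ∃ i j, hilbertDist x y = Real.log (x i / y i) - Real.log (x j / y j) := by
  obtain ⟨i, hi⟩ := exists_eq_ciSup_of_finite (f := fun k => x k / y k)
  obtain ⟨j, hj⟩ := exists_eq_ciInf_of_finite (f := fun k => x k / y k)
  refine ⟨i, j, ?_⟩
  rw [hilbertDist, ← hi, ← hj,
    Real.log_div (div_pos (hx i) (hy i)).ne' (div_pos (hx j) (hy j)).ne']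

theorem hilbertDist_nonneg {d : ℕ} [Nonempty (Fin d)] {x y : Fin d → ℝ}
    (hx : ∀ i, 0 < x i) (hy : ∀ i, 0 < y i) : 0 ≤ hilbertDist x y := by
  obtain ⟨i⟩ := ‹Nonempty (Fin d)›
  simpa using log_sub_log_le_hilbertDist hx hy i i

theorem hilbertDist_pos {d : ℕ} [Nonempty (Fin d)] {x y : Fin d → ℝ}
    (hx : ∀ i, 0 < x i) (hy : ∀ i, 0 < y i) (hxy : ∀ α : ℝ, 0 < α → y ≠ α • x) :
    0 < hilbertDist x y := by
  by_contra! h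
  obtain ⟨j⟩ := ‹Nonempty (Fin d)›
  refine hxy (y j / x j) (div_pos (hy j) (hx j)) (funext fun i => ?_)
  have hij := log_sub_log_le_hilbertDist hx hy i j
  have hji := log_sub_log_le_hilbertDist hx hy j i
  have heq : x i / y i = x j / y j :=
    Real.log_injOn_pos (div_pos (hx i) (hy i)) (div_pos (hx j) (hy j)) (by linarith)
  have hi := hx i
  have hj := hx j
  have hi' := hy i
  have hj' := hy j
  rw [div_eq_div_iff hi'.ne' hj'.ne'] at heq
  simp only [Pi.smul_apply, smul_eq_mul]
  field_simp
  linarith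

theorem psi_le {d : ℕ} (A : Matrix (Fin d) (Fin d) ℝ) (i j k l : Fin d) :
    psi A ≤ (A i k * A j l) / (A i l * A j k) := by
  have bdd : ∀ f : Fin d → ℝ, BddBelow (Set.range f) := fun f => (Set.finite_range f).bddBelow
  exact ciInf_le_of_le (bdd _) i <| ciInf_le_of_le (bdd _) j <|
    ciInf_le_of_le (bdd _) k <| ciInf_le (bdd _) l

theorem exists_psi_eq {d : ℕ} [Nonempty (Fin d)] (A : Matrix (Fin d) (Fin d) ℝ) :
    ∃ i j k l, psi A = (A i k * A j l) / (A i l * A j k) := by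
  obtain ⟨i, hi⟩ := exists_eq_ciInf_of_finite
    (f := fun i => ⨅ j, ⨅ k, ⨅ l, (A i k * A j l) / (A i l * A j k))
  obtain ⟨j, hj⟩ := exists_eq_ciInf_of_finite
    (f := fun j => ⨅ k, ⨅ l, (A i k * A j l) / (A i l * A j k))
  obtain ⟨k, hk⟩ := exists_eq_ciInf_of_finite
    (f := fun k => ⨅ l, (A i k * A j l) / (A i l * A j k))
  obtain ⟨l, hl⟩ := exists_eq_ciInf_of_finite
    (f := fun l => (A i k * A j l) / (A i l * A j k))
  exact ⟨i, j, k, l, by rw [psi, ← hi, ← hj, ← hk, ← hl]⟩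

theorem psi_pos {d : ℕ} [Nonempty (Fin d)] {A : Matrix (Fin d) (Fin d) ℝ}
    (hA : ∀ i j, 0 < A i j) : 0 < psi A := by
  obtain ⟨i, j, k, l, h⟩ := exists_psi_eq A
  rw [h]
  exact div_pos (mul_pos (hA _ _) (hA _ _)) (mul_pos (hA _ _) (hA _ _))

theorem psi_le_one {d : ℕ} [Nonempty (Fin d)] {A : Matrix (Fin d) (Fin d) ℝ}
    (hA : ∀ i j, 0 < A i j) : psi A ≤ 1 := by
  obtain ⟨i⟩ := ‹Nonempty (Fin d)›
  have h := psi_le A i i i i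
  rwa [div_self (mul_pos (hA i i) (hA i i)).ne'] at h

theorem birkhoffL_nonneg {d : ℕ} [Nonempty (Fin d)] {A : Matrix (Fin d) (Fin d) ℝ}
    (hA : ∀ i j, 0 < A i j) : 0 ≤ birkhoffL A :=
  div_nonneg (sub_nonneg.2 (Real.sqrt_le_one.2 (psi_le_one hA))) (by positivity)

theorem birkhoffL_lt_one {d : ℕ} [Nonempty (Fin d)] {A : Matrix (Fin d) (Fin d) ℝ}
    (hA : ∀ i j, 0 < A i j) : birkhoffL A < 1 := by
  have := Real.sqrt_pos.2 (psi_pos hA)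
  rw [birkhoffL, div_lt_one (by positivity)]
  linarith

theorem mulVec_pos {d : ℕ} {A : Matrix (Fin d) (Fin d) ℝ} (hA : ∀ i j, 0 < A i j)
    {x : Fin d → ℝ} (hx : ∀ i, 0 < x i) (i : Fin d) : 0 < A.mulVec x i :=
  sum_pos (fun k _ => mul_pos (hA i k) (hx k)) ⟨i, mem_univ i⟩

/-- Two probabilities whose odds differ by a factor at most `1 / ψ` differ by at most
`(1 - √ψ) / (1 + √ψ)`. -/
theorem sub_le_of_odds_le {P Q ψ : ℝ} (hψ0 : 0 ≤ ψ) (hψ1 : ψ ≤ 1) (hP0 : 0 ≤ P) (hP1 : P ≤ 1)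
    (hQ0 : 0 ≤ Q) (hQ1 : Q ≤ 1) (h : ψ * (P * (1 - Q)) ≤ Q * (1 - P)) :
    P - Q ≤ (1 - √ψ) / (1 + √ψ) := by
  have hP1' := sub_nonneg.2 hP1
  have hQ1' := sub_nonneg.2 hQ1
  set s := √ψ with hs
  have hs0 : 0 ≤ s := Real.sqrt_nonneg ψ
  have hs1 : s ≤ 1 := Real.sqrt_le_one.2 hψ1
  set a := √(P * (1 - Q)) with ha
  set b := √(Q * (1 - P)) with hb
  have ha2 : a ^ 2 = P * (1 - Q) := Real.sq_sqrt (by positivity)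
  have hb2 : b ^ 2 = Q * (1 - P) := Real.sq_sqrt (by positivity)
  have ha0 : 0 ≤ a := Real.sqrt_nonneg _
  have hb0 : 0 ≤ b := Real.sqrt_nonneg _
  have hsab : s * a ≤ b := by
    rw [hs, ha, hb, ← Real.sqrt_mul hψ0]
    exact Real.sqrt_le_sqrt h
  have hprod : a * b = √(P * Q) * √((1 - P) * (1 - Q)) := by
    rw [ha, hb, ← Real.sqrt_mul (by positivity), ← Real.sqrt_mul (by positivity)]
    congr 1
    ring
  have hPQ : √(P * Q) ^ 2 = P * Q := Real.sq_sqrt (by positivity)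
  have hPQ' : √((1 - P) * (1 - Q)) ^ 2 = (1 - P) * (1 - Q) := Real.sq_sqrt (by positivity)
  have hab : (a + b) ^ 2 ≤ 1 := by
    nlinarith [sq_nonneg (√(P * Q) - √((1 - P) * (1 - Q)))]
  rw [le_div_iff₀ (by positivity)]
  calc (P - Q) * (1 + s) = (1 + s) * (a - b) * (a + b) := by linear_combination (1 + s) * (hb2 - ha2)
    _ ≤ (1 - s) * (a + b) * (a + b) := by
      refine mul_le_mul_of_nonneg_right ?_ (by positivity)
      linarith
    _ ≤ 1 - s := by nlinarith

/-- If the weights `p` and `q` have cross ratios at least `ψ`, their averages of a function of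
oscillation at most `H` differ by at most `(1 - √ψ) / (1 + √ψ) * H`. -/
theorem weighted_average_sub_le {ι : Type*} [Fintype ι] [Nonempty ι] {p q c : ι → ℝ} {ψ H : ℝ}
    (hp : ∀ k, 0 < p k) (hq : ∀ k, 0 < q k) (hψ0 : 0 ≤ ψ) (hψ1 : ψ ≤ 1)
    (hpq : ∀ k l, ψ * (p k * q l) ≤ p l * q k) (hc : ∀ k l, c k - c l ≤ H) :
    (∑ k, p k * c k) / ∑ k, p k - (∑ k, q k * c k) / ∑ k, q k ≤
      (1 - √ψ) / (1 + √ψ) * H := by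
  classical
  set Sp := ∑ k, p k with hSp
  set Sq := ∑ k, q k with hSq
  have hSp0 : 0 < Sp := sum_pos (fun k _ => hp k) univ_nonempty
  have hSq0 : 0 < Sq := sum_pos (fun k _ => hq k) univ_nonempty
  obtain ⟨m, hm⟩ := Finite.exists_min c
  have hH : 0 ≤ H := by simpa using hc m m
  set S : Finset ι := univ.filter fun k => q k / Sq < p k / Sp with hS
  set p₁ := ∑ k ∈ S, p k with hp₁
  set p₂ := ∑ k ∈ Sᶜ, p k with hp₂
  set q₁ := ∑ k ∈ S, q k with hq₁
  set q₂ := ∑ k ∈ Sᶜ, q k with hq₂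
  have hp₁0 : 0 ≤ p₁ := sum_nonneg fun k _ => (hp k).le
  have hp₂0 : 0 ≤ p₂ := sum_nonneg fun k _ => (hp k).le
  have hq₁0 : 0 ≤ q₁ := sum_nonneg fun k _ => (hq k).le
  have hq₂0 : 0 ≤ q₂ := sum_nonneg fun k _ => (hq k).le
  have hpS : p₁ + p₂ = Sp := sum_add_sum_compl S p
  have hqS : q₁ + q₂ = Sq := sum_add_sum_compl S q
  have hcross : ψ * (p₁ * q₂) ≤ p₂ * q₁ := by
    rw [mul_comm p₂, hp₁, hq₂, hq₁, hp₂, sum_mul_sum, sum_mul_sum, mul_sum]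
    refine sum_le_sum fun k _ => ?_
    rw [mul_sum]
    exact sum_le_sum fun l _ => (hpq k l).trans_eq (mul_comm _ _)
  have hprob : p₁ / Sp - q₁ / Sq ≤ (1 - √ψ) / (1 + √ψ) := by
    refine sub_le_of_odds_le hψ0 hψ1 (by positivity) ((div_le_one hSp0).2 (by linarith))
      (by positivity) ((div_le_one hSq0).2 (by linarith)) ?_
    have hp' : 1 - p₁ / Sp = p₂ / Sp := by field_simp; linarith
    have hq' : 1 - q₁ / Sq = q₂ / Sq := by field_simp; linarith
    rw [hp', hq']
    calc ψ * (p₁ / Sp * (q₂ / Sq)) = ψ * (p₁ * q₂) / (Sp * Sq) := by field_simp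
      _ ≤ p₂ * q₁ / (Sp * Sq) := by gcongr
      _ = q₁ / Sq * (p₂ / Sp) := by field_simp
  have hdiff : (∑ k, p k * c k) / Sp - (∑ k, q k * c k) / Sq =
      ∑ k, (p k / Sp - q k / Sq) * (c k - c m) := by
    have hp' : ∑ k, p k / Sp = 1 := by rw [← sum_div, ← hSp, div_self hSp0.ne']
    have hq' : ∑ k, q k / Sq = 1 := by rw [← sum_div, ← hSq, div_self hSq0.ne']
    simp_rw [mul_sub]
    rw [sum_sub_distrib, ← sum_mul, sum_sub_distrib, hp', hq', sum_div, sum_div,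
      ← sum_sub_distrib]
    simp only [sub_self, zero_mul, sub_zero]
    exact sum_congr rfl fun k _ => by ring
  have hterm : ∑ k, (p k / Sp - q k / Sq) * (c k - c m) ≤
      ∑ k ∈ S, (p k / Sp - q k / Sq) * H := by
    rw [← sum_add_sum_compl S]
    have h₁ : ∑ k ∈ S, (p k / Sp - q k / Sq) * (c k - c m) ≤
        ∑ k ∈ S, (p k / Sp - q k / Sq) * H := by
      refine sum_le_sum fun k hk => mul_le_mul_of_nonneg_left (hc k m) ?_
      exact sub_nonneg.2 (mem_filter.1 hk).2.le
    have h₂ : ∑ k ∈ Sᶜ, (p k / Sp - q k / Sq) * (c k - c m) ≤ 0 := by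
      refine sum_nonpos fun k hk => mul_nonpos_of_nonpos_of_nonneg ?_ (sub_nonneg.2 (hm k))
      simpa [hS] using hk
    linarith
  calc _ ≤ ∑ k ∈ S, (p k / Sp - q k / Sq) * H := hdiff.trans_le hterm
    _ = (p₁ / Sp - q₁ / Sq) * H := by
      rw [← sum_mul, sum_sub_distrib, ← sum_div, ← sum_div]
    _ ≤ _ := mul_le_mul_of_nonneg_right hprob hH

/-- The derivative of `log ∑ₖ pₖ exp (t cₖ)` is the average of `c` for the tilted weights. -/
theorem hasDerivAt_log_sum_exp {ι : Type*} [Fintype ι] [Nonempty ι] {p : ι → ℝ}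
    (hp : ∀ k, 0 < p k) (c : ι → ℝ) (t : ℝ) :
    HasDerivAt (fun t => Real.log (∑ k, p k * Real.exp (t * c k)))
      ((∑ k, p k * Real.exp (t * c k) * c k) / ∑ k, p k * Real.exp (t * c k)) t := by
  have hsum : HasDerivAt (fun t => ∑ k, p k * Real.exp (t * c k))
      (∑ k, p k * Real.exp (t * c k) * c k) t := by
    refine HasDerivAt.fun_sum fun k _ => ?_
    simpa [mul_assoc] using (((hasDerivAt_id t).mul_const (c k)).exp.const_mul (p k))
  exact hsum.log (sum_pos (fun k _ => mul_pos (hp k) (Real.exp_pos _)) univ_nonempty).ne'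

theorem hilbertDist_mulVec_le {d : ℕ} [Nonempty (Fin d)] {A : Matrix (Fin d) (Fin d) ℝ}
    (hA : ∀ i j, 0 < A i j) {x y : Fin d → ℝ} (hx : ∀ i, 0 < x i) (hy : ∀ i, 0 < y i) :
    hilbertDist (A.mulVec x) (A.mulVec y) ≤ birkhoffL A * hilbertDist x y := by
  obtain ⟨i, j, hij⟩ := exists_hilbertDist_eq (mulVec_pos hA hx) (mulVec_pos hA hy)
  set c : Fin d → ℝ := fun k => Real.log (x k / y k) with hc
  set F : Fin d → ℝ → ℝ := fun i t => Real.log (∑ k, A i k * y k * Real.exp (t * c k)) with hF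
  have hpos : ∀ i k, 0 < A i k * y k := fun i k => mul_pos (hA i k) (hy k)
  have hderiv : ∀ t, HasDerivAt (fun t => F i t - F j t) _ t := fun t =>
    (hasDerivAt_log_sum_exp (hpos i) c t).sub (hasDerivAt_log_sum_exp (hpos j) c t)
  have hF0 : ∀ i, F i 0 = Real.log (A.mulVec y i) := fun i => by
    simp [hF, Matrix.mulVec, dotProduct]
  have hF1 : ∀ i, F i 1 = Real.log (A.mulVec x i) := fun i => by
    simp only [hF, Matrix.mulVec, dotProduct, one_mul]
    congr 1
    refine sum_congr rfl fun k _ => ?_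
    rw [hc, Real.exp_log (div_pos (hx k) (hy k)), mul_assoc, mul_div_cancel₀ _ (hy k).ne']
  obtain ⟨t, -, ht⟩ := exists_hasDerivAt_eq_slope (fun t => F i t - F j t) _ zero_lt_one
    (fun t _ => (hderiv t).continuousAt.continuousWithinAt) fun t _ => hderiv t
  have hbound := weighted_average_sub_le (p := fun k => A i k * y k * Real.exp (t * c k))
    (q := fun k => A j k * y k * Real.exp (t * c k)) (c := c)
    (fun k => mul_pos (hpos i k) (Real.exp_pos _)) (fun k => mul_pos (hpos j k) (Real.exp_pos _))
    (psi_pos hA).le (psi_le_one hA) (fun k l => ?_) (log_sub_log_le_hilbertDist hx hy)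
  · rw [ht, hF0, hF0, hF1, hF1] at hbound
    rw [hij, Real.log_div (mulVec_pos hA hx i).ne' (mulVec_pos hA hy i).ne',
      Real.log_div (mulVec_pos hA hx j).ne' (mulVec_pos hA hy j).ne', birkhoffL]
    linarith
  · have hψ := (le_div_iff₀ (mul_pos (hA i k) (hA j l))).1 (psi_le A i j l k)
    have hw := mul_le_mul_of_nonneg_right hψ (mul_pos
      (mul_pos (hy k) (Real.exp_pos (t * c k))) (mul_pos (hy l) (Real.exp_pos (t * c l)))).le
    linarith

/-- A Lipschitz constant `s` of `A` for the Hilbert pseudo-metric dominates the infinitesimal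
expansion in a coordinate direction. -/
theorem coordinate_share_sub_le {d : ℕ} {A : Matrix (Fin d) (Fin d) ℝ} (hA : ∀ i j, 0 < A i j)
    {s : ℝ} (hs0 : 0 ≤ s)
    (hs : ∀ x y : Fin d → ℝ, (∀ i, 0 < x i) → (∀ i, 0 < y i) → (∀ α : ℝ, 0 < α → y ≠ α • x) →
      hilbertDist (A.mulVec x) (A.mulVec y) ≤ s * hilbertDist x y)
    {y : Fin d → ℝ} (hy : ∀ i, 0 < y i) (i j : Fin d) {k l : Fin d} (hkl : k ≠ l) :
    A i k * y k / A.mulVec y i - A j k * y k / A.mulVec y j ≤ s := by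
  have : Nonempty (Fin d) := ⟨k⟩
  set c : Fin d → ℝ := Pi.single k 1 with hc
  set F : Fin d → ℝ → ℝ := fun i t => Real.log (∑ k, A i k * y k * Real.exp (t * c k)) with hF
  have hpos : ∀ i k, 0 < A i k * y k := fun i k => mul_pos (hA i k) (hy k)
  have hderiv : HasDerivAt (fun t => F i t - F j t)
      (A i k * y k / A.mulVec y i - A j k * y k / A.mulVec y j) 0 := by
    refine ((hasDerivAt_log_sum_exp (hpos i) c 0).sub
      (hasDerivAt_log_sum_exp (hpos j) c 0)).congr_deriv ?_
    simp [hc, Matrix.mulVec, dotProduct, Pi.single_apply]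
  have hF0 : ∀ i, F i 0 = Real.log (A.mulVec y i) := fun i => by
    simp [hF, Matrix.mulVec, dotProduct]
  have hslope : ∀ t : ℝ, 0 < t → (F i t - F j t) - (F i 0 - F j 0) ≤ s * t := by
    intro t ht
    set x : Fin d → ℝ := fun m => y m * Real.exp (t * c m) with hxdef
    have hx : ∀ m, 0 < x m := fun m => mul_pos (hy m) (Real.exp_pos _)
    have hlog : ∀ m, Real.log (x m / y m) = t * c m := fun m => by
      rw [hxdef, mul_div_cancel_left₀ _ (hy m).ne', Real.log_exp]
    have hFt : ∀ i, F i t = Real.log (A.mulVec x i) := fun i => by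
      simp [hF, hxdef, Matrix.mulVec, dotProduct, mul_assoc]
    have hne : ∀ α : ℝ, 0 < α → y ≠ α • x := by
      intro α _ h
      have hl := congrFun h l
      have hk := congrFun h k
      simp only [hxdef, hc, Pi.smul_apply, smul_eq_mul, Pi.single_eq_same,
        Pi.single_eq_of_ne hkl.symm, mul_zero, mul_one, Real.exp_zero] at hl hk
      have hα : α = 1 := by
        have := (hy l).ne'
        field_simp at hl
        linarith
      have := Real.one_lt_exp_iff.2 ht
      rw [hα] at hk
      nlinarith [hy k]
    have hdist : hilbertDist x y ≤ t := by
      obtain ⟨m, n, hmn⟩ := exists_hilbertDist_eq hx hy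
      rw [hmn, hlog, hlog, ← mul_sub]
      refine mul_le_of_le_one_right ht.le ?_
      simp only [hc, Pi.single_apply]
      split_ifs <;> norm_num
    have h := log_sub_log_le_hilbertDist (mulVec_pos hA hx) (mulVec_pos hA hy) i j
    rw [Real.log_div (mulVec_pos hA hx i).ne' (mulVec_pos hA hy i).ne',
      Real.log_div (mulVec_pos hA hx j).ne' (mulVec_pos hA hy j).ne'] at h
    have h' := (hs x y hx hy hne).trans (mul_le_mul_of_nonneg_left hdist hs0)
    rw [hFt, hFt, hF0, hF0]
    linarith
  refine le_of_tendsto ((hasDerivWithinAt_iff_tendsto_slope' Set.self_notMem_Ioi).1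
    (hderiv.hasDerivWithinAt (s := Set.Ioi 0))) ?_
  filter_upwards [self_mem_nhdsWithin] with t ht
  rw [slope_def_field, sub_zero, div_le_iff₀ ht]
  exact hslope t ht

theorem birkhoffL_le_of_lipschitz {d : ℕ} [Nonempty (Fin d)] {A : Matrix (Fin d) (Fin d) ℝ}
    (hA : ∀ i j, 0 < A i j) {s : ℝ} (hs0 : 0 ≤ s)
    (hs : ∀ x y : Fin d → ℝ, (∀ i, 0 < x i) → (∀ i, 0 < y i) → (∀ α : ℝ, 0 < α → y ≠ α • x) →
      hilbertDist (A.mulVec x) (A.mulVec y) ≤ s * hilbertDist x y) :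
    birkhoffL A ≤ s := by
  obtain ⟨i, j, k, l, hψ⟩ := exists_psi_eq A
  rcases eq_or_ne k l with rfl | hkl
  · rw [div_self (mul_pos (hA _ _) (hA _ _)).ne'] at hψ
    simpa [birkhoffL, hψ] using hs0
  set r := √(psi A) with hr
  have hr0 : 0 < r := Real.sqrt_pos.2 (psi_pos hA)
  have hr2 : r ^ 2 = psi A := Real.sq_sqrt (psi_pos hA).le
  have hik := hA i k
  have hil := hA i l
  have hjk := hA j k
  have hjl := hA j l
  set Y := A j l / (r * A j k) with hY
  have hY0 : 0 < Y := by positivity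
  set w : Fin d → ℝ := Pi.single k Y + Pi.single l 1 with hw
  have hwk : w k = Y := by simp [hw, hkl]
  have hw0 : ∀ m, 0 ≤ w m := fun m =>
    add_nonneg ((Pi.single_nonneg.2 hY0.le : (0 : Fin d → ℝ) ≤ Pi.single k Y) m)
      ((Pi.single_nonneg.2 zero_le_one : (0 : Fin d → ℝ) ≤ Pi.single l 1) m)
  have hAw : ∀ i, A.mulVec w i = A i k * Y + A i l := fun i => by
    simp [hw, Matrix.mulVec_add, mul_comm]
  have hAw0 : ∀ i, 0 < A.mulVec w i := fun i => by
    rw [hAw]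
    exact add_pos (mul_pos (hA i k) hY0) (hA i l)
  have hbound : ∀ δ : ℝ, 0 < δ → A j k * (w k + δ) / A.mulVec (fun m => w m + δ) j -
      A i k * (w k + δ) / A.mulVec (fun m => w m + δ) i ≤ s := fun δ hδ =>
    coordinate_share_sub_le hA hs0 hs (y := fun m => w m + δ)
      (fun m => add_pos_of_nonneg_of_pos (hw0 m) hδ) j i hkl
  have hlim : ∀ i, ContinuousAt
      (fun δ : ℝ => A i k * (w k + δ) / A.mulVec (fun m => w m + δ) i) 0 := fun i => by
    have hcont : Continuous fun δ : ℝ => ∑ m, A i m * (w m + δ) := by fun_prop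
    exact ContinuousAt.div (by fun_prop) hcont.continuousAt (by simpa using (hAw0 i).ne')
  have hle : A j k * w k / A.mulVec w j - A i k * w k / A.mulVec w i ≤ s := by
    have h := ((hlim j).sub (hlim i)).tendsto.mono_left (nhdsWithin_le_nhds (s := Set.Ioi 0))
    have h0 : A j k * (w k + 0) / A.mulVec (fun m => w m + 0) j -
        A i k * (w k + 0) / A.mulVec (fun m => w m + 0) i ≤ s :=
      le_of_tendsto h (by filter_upwards [self_mem_nhdsWithin] with δ hδ using hbound δ hδ)
    simpa only [add_zero] using h0
  have hj : A j k * Y / (A j k * Y + A j l) = 1 / (1 + r) := by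
    rw [hY]
    field_simp
  have hi : A i k * Y / (A i k * Y + A i l) = r / (1 + r) := by
    have hYr : A i k * Y = r * A i l := by
      rw [hψ] at hr2
      rw [hY]
      field_simp at hr2 ⊢
      linarith
    rw [hYr]
    field_simp
    ring
  rw [hAw, hAw, hwk, hj, hi, ← sub_div] at hle
  exact hle

/-- Birkhoff's theorem: a positive matrix maps the positive orthant into itself,
and its best Lipschitz constant for the Hilbert pseudo-metric, i.e. the supremum
of `d_H(Ax, Ay) / d_H(x, y)` over positive non-proportional pairs, equals
`L(A) = (1 − √ψ(A)) / (1 + √ψ(A)) ∈ [0, 1)`; in particular `A` is a strict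
contraction for the Hilbert pseudo-metric. -/
theorem birkhoff_contraction {d : ℕ} (hd : 2 ≤ d) (A : Matrix (Fin d) (Fin d) ℝ)
    (hA : ∀ i j, 0 < A i j) :
    (∀ x : Fin d → ℝ, (∀ i, 0 < x i) → ∀ i, 0 < A.mulVec x i) ∧
    sSup {t : ℝ | ∃ x y : Fin d → ℝ, (∀ i, 0 < x i) ∧ (∀ i, 0 < y i) ∧
        (∀ α : ℝ, 0 < α → y ≠ α • x) ∧
        t = hilbertDist (A.mulVec x) (A.mulVec y) / hilbertDist x y} = birkhoffL A ∧
    0 ≤ birkhoffL A ∧ birkhoffL A < 1 := by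
  have : Nonempty (Fin d) := ⟨⟨0, by omega⟩⟩
  have hle : ∀ x y : Fin d → ℝ, (∀ i, 0 < x i) → (∀ i, 0 < y i) → (∀ α : ℝ, 0 < α → y ≠ α • x) →
      hilbertDist (A.mulVec x) (A.mulVec y) / hilbertDist x y ≤ birkhoffL A :=
    fun x y hx hy hxy =>
      (div_le_iff₀ (hilbertDist_pos hx hy hxy)).2 (hilbertDist_mulVec_le hA hx hy)
  refine ⟨fun x hx i => mulVec_pos hA hx i, le_antisymm ?_ ?_, birkhoffL_nonneg hA,
    birkhoffL_lt_one hA⟩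
  · refine Real.sSup_le ?_ (birkhoffL_nonneg hA)
    rintro t ⟨x, y, hx, hy, hxy, rfl⟩
    exact hle x y hx hy hxy
  · refine birkhoffL_le_of_lipschitz hA (Real.sSup_nonneg ?_) fun x y hx hy hxy => ?_
    · rintro t ⟨x, y, hx, hy, -, rfl⟩
      exact div_nonneg (hilbertDist_nonneg (mulVec_pos hA hx) (mulVec_pos hA hy))
        (hilbertDist_nonneg hx hy)
    · rw [← div_le_iff₀ (hilbertDist_pos hx hy hxy)]
      refine le_csSup ⟨birkhoffL A, ?_⟩ ⟨x, y, hx, hy, hxy, rfl⟩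
      rintro t ⟨x, y, hx, hy, hxy, rfl⟩
      exact hle x y hx hy hxy
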